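/- arXiv:2402.15681 — 3 statements merged into one kernel-verified Lean document; each statement's English description precedes it below -/
import Mathlib

section
/- Let S₁ ⊆ ℤ be a finite set with min S₁ = 0 and aperture κ = max S₁ ≥ 1, let L ≥ 1, let μ ∈ ℤ with μ > κ, set Δ = μ + κ, and let S = ⋃_{l=0}^{L-1} (S₁ + lΔ) be the corresponding Type-II sparse linear array with L equal-aperture subarrays. Then the number of degrees of freedom of S equals (2L−1) times the number of degrees of freedom of S₁, i.e., |D(S)| = (2L−1)·|D(S₁)|. -/
open Finset Pointwise

/-- The difference coarray of a sparse linear array `S ⊆ ℤ`: `D(S) = {a - b : a, b ∈ S}`. -/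
def coarray (S : Finset ℤ) : Finset ℤ := S - S

/-- Type-II sparse linear array: union of `L` translates of the reference subarray `S₁`
by multiples of the translation factor `Δ`. -/
def typeII (S₁ : Finset ℤ) (L : ℕ) (Δ : ℤ) : Finset ℤ :=
  (Finset.range L).biUnion (fun l => S₁.image (fun x => x + (l : ℤ) * Δ))

/-- The coarray of a Type-II array consists of the translates of the reference coarray
by `m * Δ` with `|m| < L`. -/
lemma coarray_typeII (S : Finset ℤ) (L : ℕ) (Δ : ℤ) :
    coarray (typeII S L Δ) =
      (Finset.Ioo (-(L : ℤ)) L ×ˢ coarray S).image (fun p => p.2 + p.1 * Δ) := by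
  ext z
  simp only [coarray, typeII, Finset.mem_sub, Finset.mem_biUnion, Finset.mem_range,
    Finset.mem_image, Finset.mem_product, Finset.mem_Ioo, Prod.exists]
  constructor
  · rintro ⟨_, ⟨k, hk, x, hx, rfl⟩, _, ⟨l, hl, y, hy, rfl⟩, rfl⟩
    exact ⟨k - l, x - y, ⟨⟨by omega, by omega⟩, x, hx, y, hy, rfl⟩, by ring⟩
  · rintro ⟨m, _, ⟨⟨hm, hm'⟩, x, hx, y, hy, rfl⟩, rfl⟩
    refine ⟨_, ⟨m.toNat, by omega, x, hx, rfl⟩, _, ⟨(-m).toNat, by omega, y, hy, rfl⟩, ?_⟩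
    have h : (m.toNat : ℤ) - ((-m).toNat : ℤ) = m := by omega
    linear_combination Δ * h

/-- Translates by distinct multiples of `Δ` of a set contained in an interval `[-κ, κ]` with
`2 * κ < Δ` do not overlap. -/
lemma injOn_add_mul {D : Finset ℤ} {κ Δ : ℤ} (hD : ∀ d ∈ D, |d| ≤ κ) (hΔ : 2 * κ < Δ)
    (I : Finset ℤ) :
    Set.InjOn (fun p : ℤ × ℤ => p.2 + p.1 * Δ) (I ×ˢ D : Finset (ℤ × ℤ)) := by
  rintro ⟨m, d⟩ h ⟨n, e⟩ h' heq
  have hd := abs_le.mp (hD d (Finset.mem_product.mp h).2)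
  have he := abs_le.mp (hD e (Finset.mem_product.mp h').2)
  simp only at heq
  have hmn : m = n := by
    rcases lt_trichotomy m n with hlt | rfl | hlt
    · nlinarith
    · rfl
    · nlinarith
  subst hmn
  simpa using heq

/-- If `μ > κ`, the number of DoF of a Type-II array equals `(2L - 1)` times the
number of DoF of the reference subarray. -/
theorem typeII_dof_eq (S₁ : Finset ℤ) (h₁ : S₁.Nonempty) (κ : ℤ)
    (hmin : S₁.min' h₁ = 0) (hmax : S₁.max' h₁ = κ) (hκ : 1 ≤ κ)
    (L : ℕ) (hL : 1 ≤ L) (μ : ℤ) (hμ : κ < μ) :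
    (coarray (typeII S₁ L (μ + κ))).card = (2 * L - 1) * (coarray S₁).card := by
  have hD : ∀ d ∈ coarray S₁, |d| ≤ κ := by
    intro d hd
    obtain ⟨x, hx, y, hy, rfl⟩ := Finset.mem_sub.mp hd
    have hx₀ := S₁.min'_le x hx
    have hy₀ := S₁.min'_le y hy
    have hx₁ := S₁.le_max' x hx
    have hy₁ := S₁.le_max' y hy
    rw [abs_le]
    omega
  rw [coarray_typeII, Finset.card_image_of_injOn (injOn_add_mul hD (by omega) _),
    Finset.card_product, Int.card_Ioo]
  congr 1
  omega
end

section
/- Let S₁ ⊆ ℤ be a finite set with min S₁ = 0 and aperture κ = max S₁ ≥ 1, whose difference coarray is hole-free, i.e., D(S₁) = {−κ, −κ+1, …, κ} (so that the subarray degrees of freedom sDoF = |D(S₁)| = 2κ+1). Let L ≥ 1, let μ ∈ ℤ with 1 ≤ μ ≤ κ, set Δ = μ + κ, and let S = ⋃_{l=0}^{L-1} (S₁ + lΔ). Then |D(S)| ≤ L·(sDoF − 1) + 2(L−1)μ + 1. -/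
open Finset Pointwise

theorem typeII_subset_Icc {S₁ : Finset ℤ} {κ Δ : ℤ} (hS : S₁ ⊆ Finset.Icc 0 κ) (hΔ : 0 ≤ Δ)
    (L : ℕ) : typeII S₁ L Δ ⊆ Finset.Icc 0 (κ + ((L : ℤ) - 1) * Δ) := by
  intro y hy
  simp only [typeII, Finset.mem_biUnion, Finset.mem_range, Finset.mem_image] at hy
  obtain ⟨l, hl, x, hx, rfl⟩ := hy
  obtain ⟨hx0, hxκ⟩ := Finset.mem_Icc.1 (hS hx)
  have hl' : (l : ℤ) ≤ (L : ℤ) - 1 := by omega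
  exact Finset.mem_Icc.2 ⟨by positivity, by gcongr⟩

theorem coarray_subset_Icc {S : Finset ℤ} {M : ℤ} (hS : S ⊆ Finset.Icc 0 M) :
    coarray S ⊆ Finset.Icc (-M) M := by
  intro y hy
  obtain ⟨a, ha, b, hb, rfl⟩ := Finset.mem_sub.1 hy
  have ha' := Finset.mem_Icc.1 (hS ha)
  have hb' := Finset.mem_Icc.1 (hS hb)
  exact Finset.mem_Icc.2 ⟨by omega, by omega⟩

/-- If the reference subarray has a hole-free difference coarray and `1 ≤ μ ≤ κ`, then the
DoF of the Type-II array is at most `L(sDoF - 1) + 2(L-1)μ + 1`, where `sDoF = |D(S₁)|`. -/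
theorem typeII_dof_le (S₁ : Finset ℤ) (h₁ : S₁.Nonempty) (κ : ℤ)
    (hmin : S₁.min' h₁ = 0) (hmax : S₁.max' h₁ = κ) (hκ : 1 ≤ κ)
    (hholefree : coarray S₁ = Finset.Icc (-κ) κ)
    (L : ℕ) (hL : 1 ≤ L) (μ : ℤ) (hμ1 : 1 ≤ μ) (hμ2 : μ ≤ κ) :
    ((coarray (typeII S₁ L (μ + κ))).card : ℤ) ≤
      (L : ℤ) * (((coarray S₁).card : ℤ) - 1) + 2 * ((L : ℤ) - 1) * μ + 1 := by
  have hS : S₁ ⊆ Finset.Icc 0 κ := fun x hx =>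
    Finset.mem_Icc.2 ⟨hmin ▸ S₁.min'_le x hx, hmax ▸ S₁.le_max' x hx⟩
  have hL' : (0 : ℤ) ≤ (L : ℤ) - 1 := by omega
  have hM : 0 ≤ κ + ((L : ℤ) - 1) * (μ + κ) :=
    add_nonneg (by omega) (mul_nonneg hL' (by omega))
  have hcard := Finset.card_le_card
    (coarray_subset_Icc (typeII_subset_Icc hS (by omega : 0 ≤ μ + κ) L))
  rw [Int.card_Icc] at hcard
  have hκcard : ((coarray S₁).card : ℤ) = 2 * κ + 1 := by
    rw [hholefree, Int.card_Icc]
    omega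
  rw [hκcard]
  calc ((coarray (typeII S₁ L (μ + κ))).card : ℤ)
      ≤ 2 * (κ + ((L : ℤ) - 1) * (μ + κ)) + 1 := by omega
    _ = (L : ℤ) * (2 * κ + 1 - 1) + 2 * ((L : ℤ) - 1) * μ + 1 := by ring
end

section
/- Let S₁ ⊆ ℤ be a finite set with min S₁ = 0 and aperture κ = max S₁ ≥ 1 whose difference coarray is hole-free (D(S₁) = {−κ, …, κ}), let L ≥ 1, let μ ∈ ℤ with 1 ≤ μ ≤ κ, set Δ = μ + κ, and let S = ⋃_{l=0}^{L-1} (S₁ + lΔ). Then D(S) equals the full integer interval {−((L−1)Δ + κ), …, (L−1)Δ + κ}, and consequently |D(S)| = L·(|D(S₁)| − 1) + 2(L−1)μ + 1 exactly. -/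
open Finset Pointwise

theorem mem_coarray {S : Finset ℤ} {d : ℤ} :
    d ∈ coarray S ↔ ∃ a ∈ S, ∃ b ∈ S, a - b = d := by
  simp only [coarray, Finset.mem_sub]

theorem mem_typeII {S₁ : Finset ℤ} {L : ℕ} {Δ a : ℤ} :
    a ∈ typeII S₁ L Δ ↔ ∃ l < L, ∃ x ∈ S₁, x + (l : ℤ) * Δ = a := by
  simp only [typeII, Finset.mem_biUnion, Finset.mem_range, Finset.mem_image]

/-- The coarray of a Type-II array is the union of the translates of the coarray of its
reference subarray by `jΔ`, `|j| ≤ n`, where `n + 1` is the number of subarrays. -/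
theorem mem_coarray_typeII_succ {S₁ : Finset ℤ} {n : ℕ} {Δ d : ℤ} :
    d ∈ coarray (typeII S₁ (n + 1) Δ) ↔
      ∃ j : ℤ, -n ≤ j ∧ j ≤ n ∧ d - j * Δ ∈ coarray S₁ := by
  simp only [mem_coarray, mem_typeII]
  constructor
  · rintro ⟨_, ⟨l, hl, x, hx, rfl⟩, _, ⟨m, hm, y, hy, rfl⟩, rfl⟩
    exact ⟨(l : ℤ) - m, by omega, by omega, x, hx, y, hy, by ring⟩
  · rintro ⟨j, hj₁, hj₂, x, hx, y, hy, hxy⟩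
    obtain ⟨m, rfl | rfl⟩ := j.eq_nat_or_neg
    · exact ⟨_, ⟨m, by omega, x, hx, rfl⟩, _, ⟨0, by omega, y, hy, rfl⟩,
        by push_cast; linarith⟩
    · exact ⟨_, ⟨0, by omega, x, hx, rfl⟩, _, ⟨m, by omega, y, hy, rfl⟩,
        by push_cast; linarith⟩

/-- Intervals of radius `κ` centred at the multiples `jΔ`, `|j| ≤ n`, leave no gap
when `Δ ≤ 2κ`. -/
theorem exists_sub_mul_mem_Icc {κ Δ : ℤ} (hΔ : Δ ≤ 2 * κ) (n : ℕ) {d : ℤ}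
    (hd : d ∈ Finset.Icc (-(n * Δ + κ)) (n * Δ + κ)) :
    ∃ j : ℤ, -n ≤ j ∧ j ≤ n ∧ d - j * Δ ∈ Finset.Icc (-κ) κ := by
  simp only [Finset.mem_Icc] at hd ⊢
  induction n with
  | zero => exact ⟨0, by simp, by simp, by simpa using hd⟩
  | succ n ih =>
    push_cast at hd ⊢
    rcases lt_or_ge (n * Δ + κ) d with h | h
    · exact ⟨n + 1, by omega, le_rfl, by linarith, by linarith⟩
    rcases lt_or_ge d (-(n * Δ + κ)) with h' | h'
    · exact ⟨-(n + 1), le_rfl, by omega, by linarith, by linarith⟩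
    obtain ⟨j, hj₁, hj₂, hj⟩ := ih ⟨h', h⟩
    exact ⟨j, by omega, by omega, hj⟩

/-- If the reference subarray has a hole-free difference coarray and `1 ≤ μ ≤ κ`, the
difference coarray of the Type-II array is the full integer interval
`[-((L-1)Δ + κ), (L-1)Δ + κ]`, and its DoF equals `L(|D(S₁)| - 1) + 2(L-1)μ + 1` exactly. -/
theorem typeII_coarray_holefree (S₁ : Finset ℤ) (h₁ : S₁.Nonempty) (κ : ℤ)
    (hmin : S₁.min' h₁ = 0) (hmax : S₁.max' h₁ = κ) (hκ : 1 ≤ κ)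
    (hholefree : coarray S₁ = Finset.Icc (-κ) κ)
    (L : ℕ) (hL : 1 ≤ L) (μ : ℤ) (hμ1 : 1 ≤ μ) (hμ2 : μ ≤ κ) :
    coarray (typeII S₁ L (μ + κ)) =
      Finset.Icc (-(((L : ℤ) - 1) * (μ + κ) + κ)) (((L : ℤ) - 1) * (μ + κ) + κ) ∧
    ((coarray (typeII S₁ L (μ + κ))).card : ℤ) =
      (L : ℤ) * (((coarray S₁).card : ℤ) - 1) + 2 * ((L : ℤ) - 1) * μ + 1 := by
  obtain ⟨n, rfl⟩ : ∃ n, L = n + 1 := ⟨L - 1, by omega⟩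
  have hD : coarray (typeII S₁ (n + 1) (μ + κ)) =
      Finset.Icc (-(n * (μ + κ) + κ)) (n * (μ + κ) + κ) := by
    ext d
    rw [mem_coarray_typeII_succ, hholefree]
    refine ⟨?_, exists_sub_mul_mem_Icc (by linarith) n⟩
    rintro ⟨j, hj₁, hj₂, hj⟩
    rw [Finset.mem_Icc] at hj ⊢
    have hΔ : 0 ≤ μ + κ := by linarith
    have h₁ := mul_le_mul_of_nonneg_right hj₁ hΔ
    have h₂ := mul_le_mul_of_nonneg_right hj₂ hΔ
    constructor <;> linarith
  have hn : ((n + 1 : ℕ) : ℤ) - 1 = n := by push_cast; ring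
  have hpos : 0 ≤ (n : ℤ) * (μ + κ) := mul_nonneg n.cast_nonneg (by linarith)
  rw [hn]
  refine ⟨hD, ?_⟩
  rw [hD, hholefree, Int.card_Icc, Int.card_Icc, Int.toNat_of_nonneg (by linarith),
    Int.toNat_of_nonneg (by linarith)]
  push_cast
  ring
end
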